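/- arXiv:2411.01459 — 7 statements merged into one kernel-verified Lean document; each statement's English description precedes it below -/
import Mathlib

section
/- Fix a ∈ ℝ and let ξ(H,r) := 1/(2·ρ_a(H,r)) on ℍ. Then the function x(H,r) := (1/2)·(1 − (H+a)/ρ_a(H,r)) satisfies, at every point of ℍ, the equations ∂x/∂H = r·∂ξ/∂r and ∂x/∂r = −r·∂ξ/∂H; that is, x is a primitive of the 1-form r·(∂ξ/∂r·dH − ∂ξ/∂H·dr). -/
theorem hasDerivAt_sqrt_shift_sq_add_sq_left (a H r : ℝ) (hr : 0 < r) :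
    HasDerivAt (fun H' => Real.sqrt ((H' + a)^2 + r^2))
      ((H + a) / Real.sqrt ((H + a)^2 + r^2)) H := by
  have hpos : (H + a)^2 + r^2 ≠ 0 := by positivity
  have h := ((((hasDerivAt_id H).add_const a).pow 2).add_const (r^2)).sqrt hpos
  refine h.congr_deriv ?_
  simp only [id, Nat.cast_ofNat, Nat.add_one_sub_one, pow_one, mul_one]
  exact mul_div_mul_left _ _ two_ne_zero

theorem hasDerivAt_sqrt_shift_sq_add_sq_right (a H r : ℝ) (hr : 0 < r) :
    HasDerivAt (fun r' => Real.sqrt ((H + a)^2 + r'^2))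
      (r / Real.sqrt ((H + a)^2 + r^2)) r := by
  have hpos : (H + a)^2 + r^2 ≠ 0 := by positivity
  have h := (((hasDerivAt_id r).pow 2).const_add ((H + a)^2)).sqrt hpos
  refine h.congr_deriv ?_
  simp only [id, Nat.cast_ofNat, Nat.add_one_sub_one, pow_one, mul_one]
  exact mul_div_mul_left _ _ two_ne_zero

/-- For `ξ(H,r) = 1/(2·ρ_a(H,r))` with `ρ_a(H,r) = √((H+a)² + r²)`,
the function `x(H,r) = (1/2)(1 − (H+a)/ρ_a(H,r))` satisfies `∂x/∂H = r·∂ξ/∂r` and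
`∂x/∂r = −r·∂ξ/∂H` at every point of `ℍ = {(H,r) : r > 0}`. -/
theorem stmt_2 (a : ℝ) (ξ x : ℝ → ℝ → ℝ)
    (hξ : ∀ H r : ℝ, ξ H r = 1 / (2 * Real.sqrt ((H + a)^2 + r^2)))
    (hx : ∀ H r : ℝ, x H r =
      (1/2) * (1 - (H + a) / Real.sqrt ((H + a)^2 + r^2))) :
    ∀ H r : ℝ, 0 < r →
      deriv (fun H' => x H' r) H = r * deriv (fun r' => ξ H r') r ∧
      deriv (fun r' => x H r') r = -(r * deriv (fun H' => ξ H' r) H) := by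
  intro H r hr
  simp only [hξ, hx]
  have hH := hasDerivAt_sqrt_shift_sq_add_sq_left a H r hr
  have hR := hasDerivAt_sqrt_shift_sq_add_sq_right a H r hr
  have hρ : Real.sqrt ((H + a)^2 + r^2) ≠ 0 := by positivity
  have hsq : Real.sqrt ((H + a)^2 + r^2) ^ 2 = (H + a)^2 + r^2 := Real.sq_sqrt (by positivity)
  have hρ2 : 2 * Real.sqrt ((H + a)^2 + r^2) ≠ 0 := mul_ne_zero two_ne_zero hρ
  have hxH := ((((hasDerivAt_id' H).add_const a).fun_div hH hρ).const_sub 1).const_mul (1/2 : ℝ)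
  have hxr := (((hasDerivAt_const r (H + a)).fun_div hR hρ).const_sub 1).const_mul (1/2 : ℝ)
  have hξH := (hasDerivAt_const H (1 : ℝ)).fun_div (hH.const_mul 2) hρ2
  have hξr := (hasDerivAt_const r (1 : ℝ)).fun_div (hR.const_mul 2) hρ2
  rw [hxH.deriv, hxr.deriv, hξH.deriv, hξr.deriv]
  generalize Real.sqrt ((H + a)^2 + r^2) = ρ at hρ hsq
  constructor
  · field_simp
    linear_combination -hsq
  · field_simp
    ring
end

section
/- Fix a ∈ ℝ and let ξ(H,r) := (1/2)·log(H + a + ρ_a(H,r)) on ℍ (the argument of the logarithm is positive there). Then the function x(H,r) := (1/2)·(H + a − ρ_a(H,r)) satisfies, at every point of ℍ, the equations ∂x/∂H = r·∂ξ/∂r and ∂x/∂r = −r·∂ξ/∂H; that is, x is a primitive of the 1-form r·(∂ξ/∂r·dH − ∂ξ/∂H·dr). -/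
theorem add_sqrt_sq_add_sq_pos (u : ℝ) {r : ℝ} (hr : 0 < r) :
    0 < u + Real.sqrt (u^2 + r^2) := by
  have h : |u| < Real.sqrt (u^2 + r^2) :=
    Real.lt_sqrt_of_sq_lt (by rw [sq_abs]; linarith [pow_pos hr 2])
  linarith [neg_abs_le u]

theorem hasDerivAt_sqrt_sq_add_sq_right (u : ℝ) {r : ℝ} (hr : 0 < r) :
    HasDerivAt (fun r' => Real.sqrt (u^2 + r'^2)) (r / Real.sqrt (u^2 + r^2)) r := by
  have hpos : 0 < u^2 + r^2 := by positivity
  have hρ := Real.sqrt_pos.2 hpos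
  convert ((hasDerivAt_pow 2 r).const_add (u^2)).sqrt hpos.ne' using 1
  field_simp
  norm_num [mul_comm]

theorem hasDerivAt_sqrt_sq_add_sq_left (u : ℝ) {r : ℝ} (hr : 0 < r) :
    HasDerivAt (fun u' => Real.sqrt (u'^2 + r^2)) (u / Real.sqrt (u^2 + r^2)) u := by
  have hpos : 0 < u^2 + r^2 := by positivity
  have hρ := Real.sqrt_pos.2 hpos
  convert ((hasDerivAt_pow 2 u).add_const (r^2)).sqrt hpos.ne' using 1
  field_simp
  norm_num [mul_comm]


/-- For `ξ(H,r) = (1/2)·log(H + a + ρ_a(H,r))` with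
`ρ_a(H,r) = √((H+a)² + r²)` (the log argument is positive on `ℍ`), the function
`x(H,r) = (1/2)(H + a − ρ_a(H,r))` satisfies `∂x/∂H = r·∂ξ/∂r` and
`∂x/∂r = −r·∂ξ/∂H` at every point of `ℍ = {(H,r) : r > 0}`. -/
theorem stmt_3 (a : ℝ) (ξ x : ℝ → ℝ → ℝ)
    (hξ : ∀ H r : ℝ, ξ H r =
      (1/2) * Real.log (H + a + Real.sqrt ((H + a)^2 + r^2)))
    (hx : ∀ H r : ℝ, x H r =
      (1/2) * (H + a - Real.sqrt ((H + a)^2 + r^2))) :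
    ∀ H r : ℝ, 0 < r →
      deriv (fun H' => x H' r) H = r * deriv (fun r' => ξ H r') r ∧
      deriv (fun r' => x H r') r = -(r * deriv (fun H' => ξ H' r) H) := by
  intro H r hr
  obtain rfl : ξ = fun H r => (1/2) * Real.log (H + a + Real.sqrt ((H + a)^2 + r^2)) :=
    funext₂ hξ
  obtain rfl : x = fun H r => (1/2) * (H + a - Real.sqrt ((H + a)^2 + r^2)) := funext₂ hx
  have hlog := add_sqrt_sq_add_sq_pos (H + a) hr
  have hρ : 0 < Real.sqrt ((H + a)^2 + r^2) := Real.sqrt_pos.2 (by positivity)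
  have hsq : Real.sqrt ((H + a)^2 + r^2) ^ 2 = (H + a)^2 + r^2 := Real.sq_sqrt (by positivity)
  have hid : HasDerivAt (fun H' : ℝ => H' + a) 1 H := (hasDerivAt_id H).add_const a
  have hρH := hasDerivAt_sqrt_sq_add_sq_left (H + a) hr
  have hρH' : HasDerivAt (fun H' => Real.sqrt ((H' + a)^2 + r^2))
      ((H + a) / Real.sqrt ((H + a)^2 + r^2)) H := by
    simpa using hρH.comp_add_const H a
  have hρr := hasDerivAt_sqrt_sq_add_sq_right (H + a) hr
  have hxH := (hid.sub hρH').const_mul (1/2 : ℝ)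
  have hxr := (hρr.const_sub (H + a)).const_mul (1/2 : ℝ)
  have hξH := ((hid.add hρH').log hlog.ne').const_mul (1/2 : ℝ)
  have hξr := ((hρr.const_add (H + a)).log hlog.ne').const_mul (1/2 : ℝ)
  refine ⟨hxH.deriv.trans ((?_ : _ = _).trans (congrArg (r * ·) hξr.deriv.symm)),
    hxr.deriv.trans ((?_ : _ = _).trans (congrArg (fun t => -(r * t)) hξH.deriv.symm))⟩
  · field_simp
    linear_combination hsq
  · simp only [Pi.add_apply]
    field_simp
    ring
end

section
/- For every real r > 0 and all real numbers h, p, q with h < p < q, one has √(q² + r²)·(r² + h·p) > √(p² + r²)·(r² + h·q). -/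
/-- Strict Cauchy–Schwarz inequality for the vectors `(p, r)` and `(q, r)`. -/
lemma sq_add_mul_lt_sqrt_mul_sqrt {r p q : ℝ} (hr : 0 < r) (hpq : p < q) :
    r ^ 2 + p * q < √(p ^ 2 + r ^ 2) * √(q ^ 2 + r ^ 2) := by
  rw [← Real.sqrt_mul (by positivity)]
  apply Real.lt_sqrt_of_sq_lt
  have : 0 < (r * (q - p)) ^ 2 := pow_pos (mul_pos hr (sub_pos.2 hpq)) 2
  linarith

/-- The function `x ↦ x / √(x² + r²)` is strictly increasing, in cross-multiplied form. -/
lemma sqrt_mul_lt_sqrt_mul {r p q : ℝ} (hr : 0 < r) (hpq : p < q) :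
    √(q ^ 2 + r ^ 2) * p < √(p ^ 2 + r ^ 2) * q := by
  have hcs := sq_add_mul_lt_sqrt_mul_sqrt hr hpq
  have hA : 0 < √(q ^ 2 + r ^ 2) := Real.sqrt_pos.2 (by positivity)
  have hB : 0 < √(p ^ 2 + r ^ 2) := Real.sqrt_pos.2 (by positivity)
  have hA2 : √(q ^ 2 + r ^ 2) ^ 2 = q ^ 2 + r ^ 2 := Real.sq_sqrt (by positivity)
  have hB2 : √(p ^ 2 + r ^ 2) ^ 2 = p ^ 2 + r ^ 2 := Real.sq_sqrt (by positivity)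
  have hrpq : 0 < r ^ 2 * (q - p) := mul_pos (pow_pos hr 2) (sub_pos.2 hpq)
  rcases lt_or_ge 0 q with hq | hq
  · refine lt_of_mul_lt_mul_left ?_ hA.le
    linear_combination hrpq + q * hcs + p * hA2
  · refine lt_of_mul_lt_mul_left ?_ hB.le
    have hp : 0 < -p := by linarith
    linear_combination hrpq + (-p) * hcs - q * hB2

/-- For every `r > 0` and all reals `h < p < q`,
`√(q² + r²)·(r² + h·p) > √(p² + r²)·(r² + h·q)`. -/
theorem stmt_4 (r h p q : ℝ) (hr : 0 < r) (hhp : h < p) (hpq : p < q) :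
    Real.sqrt (q^2 + r^2) * (r^2 + h * p) >
      Real.sqrt (p^2 + r^2) * (r^2 + h * q) := by
  have hB : 0 < √(p ^ 2 + r ^ 2) := Real.sqrt_pos.2 (by positivity)
  have hB2 : √(p ^ 2 + r ^ 2) ^ 2 = p ^ 2 + r ^ 2 := Real.sq_sqrt (by positivity)
  have hcs := mul_lt_mul_of_pos_left (sq_add_mul_lt_sqrt_mul_sqrt hr hpq) hB
  have hmono := mul_lt_mul_of_pos_left (sqrt_mul_lt_sqrt_mul hr hpq) (sub_pos.2 hhp)
  linear_combination hcs + hmono + √(q ^ 2 + r ^ 2) * hB2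
end

section
/- For every real r > 0 and all real numbers h, p, q with p < q < h, one has √(q² + r²)·(r² + h·p) < √(p² + r²)·(r² + h·q). -/
/-- For every `r > 0` and all reals `p < q < h`,
`√(q² + r²)·(r² + h·p) < √(p² + r²)·(r² + h·q)`. -/
theorem stmt_5 (r h p q : ℝ) (hr : 0 < r) (hpq : p < q) (hqh : q < h) :
    Real.sqrt (q^2 + r^2) * (r^2 + h * p) <
      Real.sqrt (p^2 + r^2) * (r^2 + h * q) := by
  have hA : 0 < Real.sqrt (q^2 + r^2) := Real.sqrt_pos.2 (by positivity)
  have hB : 0 < Real.sqrt (p^2 + r^2) := Real.sqrt_pos.2 (by positivity)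
  have hA2 : Real.sqrt (q^2 + r^2) ^ 2 = q^2 + r^2 := Real.sq_sqrt (by positivity)
  have hB2 : Real.sqrt (p^2 + r^2) ^ 2 = p^2 + r^2 := Real.sq_sqrt (by positivity)
  generalize Real.sqrt (q^2 + r^2) = A at *
  generalize Real.sqrt (p^2 + r^2) = B at *
  have hAB : (A * B) ^ 2 = (q^2 + r^2) * (p^2 + r^2) := by rw [mul_pow, hA2, hB2]
  have hsub : 0 < q - p := sub_pos.2 hpq
  have hCS : r^2 + q * p < A * B := by
    refine lt_of_pow_lt_pow_left₀ 2 (by positivity) ?_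
    have : 0 < (r * (q - p)) ^ 2 := by positivity
    linarith
  have hCS' : p * q - r^2 ≤ A * B := by
    refine le_of_sq_le_sq ?_ (by positivity)
    linarith [sq_nonneg (r * (p + q))]
  -- The difference of the two sides is increasing in `h`, and positive at `h = q`.
  have hslope : 0 ≤ B * q - A * p := by
    refine (mul_nonneg_iff_of_pos_left (add_pos hA hB)).1 ?_
    have hfac : (A + B) * (B * q - A * p) = (q - p) * (A * B + r^2 - p * q) := by
      linear_combination q * hB2 - p * hA2
    rw [hfac]
    exact mul_nonneg hsub.le (by linarith)
  have h₁ : 0 ≤ (h - q) * (B * q - A * p) := mul_nonneg (sub_pos.2 hqh).le hslope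
  have h₂ : 0 < A * (A * B - (r^2 + q * p)) := mul_pos hA (sub_pos.2 hCS)
  linear_combination h₁ + h₂ + B * hA2
end

section
/- Let d ≥ 3 and let ν₁,…,ν_d ∈ ℝ² satisfy det(ν_i, ν_{i+1}) = −1 for 1 ≤ i ≤ d−1. Let a₁',…,a_{d−1}' be real numbers and define λ_j := Σ_{i=1}^{j−1} a_i'·det(ν_{i+1} − ν_i, ν_j) for 1 ≤ j ≤ d (so λ₁ = 0). Then for every k with 2 ≤ k ≤ d−1: λ_{k+1} + λ_{k−1} − det(ν_{k+1}, ν_{k−1})·λ_k = a_k' − a_{k−1}'. -/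
/-- Let `d ≥ 3`, `ν₁,…,ν_d ∈ ℝ²` with `det(ν_i, ν_{i+1}) = −1` for
`1 ≤ i ≤ d−1`, let `a₁',…,a_{d−1}'` be reals and
`λ_j := Σ_{i=1}^{j−1} a_i'·det(ν_{i+1} − ν_i, ν_j)` for `1 ≤ j ≤ d`. Then for
`2 ≤ k ≤ d−1`: `λ_{k+1} + λ_{k−1} − det(ν_{k+1}, ν_{k−1})·λ_k = a_k' − a_{k−1}'`.
Here `det(p,q) := p₁q₂ − p₂q₁`. -/
theorem stmt_8 (d : ℕ) (hd : 3 ≤ d) (ν : ℕ → ℝ × ℝ) (a' : ℕ → ℝ)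
    (hdet : ∀ i, 1 ≤ i → i ≤ d - 1 →
      (ν i).1 * (ν (i+1)).2 - (ν i).2 * (ν (i+1)).1 = -1)
    (lam : ℕ → ℝ)
    (hlam : ∀ j, 1 ≤ j → j ≤ d → lam j =
      ∑ i ∈ Finset.Ico 1 j, a' i *
        ((ν (i+1) - ν i).1 * (ν j).2 - (ν (i+1) - ν i).2 * (ν j).1)) :
    ∀ k, 2 ≤ k → k ≤ d - 1 →
      lam (k+1) + lam (k-1)
        - ((ν (k+1)).1 * (ν (k-1)).2 - (ν (k+1)).2 * (ν (k-1)).1) * lam k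
      = a' k - a' (k-1) := by
  intro k hk hkd
  obtain ⟨m, rfl⟩ : ∃ m, k = m + 2 := ⟨k - 2, by omega⟩
  have hpq := hdet (m + 1) (by omega) (by omega)
  have hqr := hdet (m + 2) (by omega) hkd
  have hp := hlam (m + 1) (by omega) (by omega)
  have hq := hlam (m + 2) (by omega) (by omega)
  have hr := hlam (m + 3) (by omega) (by omega)
  rw [Finset.sum_Ico_succ_top (by omega)] at hq
  rw [Finset.sum_Ico_succ_top (by omega), Finset.sum_Ico_succ_top (by omega)] at hr
  simp only [show m + 2 - 1 = m + 1 by omega, show m + 2 + 1 = m + 3 by omega,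
    show m + 1 + 1 = m + 2 by omega, Prod.fst_sub, Prod.snd_sub] at *
  rw [hp, hq, hr]
  generalize ν (m + 1) = p at *
  generalize ν (m + 2) = q at *
  generalize ν (m + 3) = r at *
  -- consecutive normals satisfy `r + p = det(r, p) • q`
  have h₁ : r.1 + p.1 = (r.1 * p.2 - r.2 * p.1) * q.1 := by
    linear_combination r.1 * hpq + p.1 * hqr
  have h₂ : r.2 + p.2 = (r.1 * p.2 - r.2 * p.1) * q.2 := by
    linear_combination r.2 * hpq + p.2 * hqr
  have hsum : ∑ i ∈ Finset.Ico 1 (m + 1),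
        a' i * (((ν (i+1)).1 - (ν i).1) * r.2 - ((ν (i+1)).2 - (ν i).2) * r.1)
      + ∑ i ∈ Finset.Ico 1 (m + 1),
        a' i * (((ν (i+1)).1 - (ν i).1) * p.2 - ((ν (i+1)).2 - (ν i).2) * p.1)
      - (r.1 * p.2 - r.2 * p.1) * ∑ i ∈ Finset.Ico 1 (m + 1),
        a' i * (((ν (i+1)).1 - (ν i).1) * q.2 - ((ν (i+1)).2 - (ν i).2) * q.1) = 0 := by
    rw [Finset.mul_sum, ← Finset.sum_add_distrib, ← Finset.sum_sub_distrib]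
    refine Finset.sum_eq_zero fun i _ => ?_
    linear_combination a' i * ((ν (i+1)).1 - (ν i).1) * h₂
      - a' i * ((ν (i+1)).2 - (ν i).2) * h₁
  linear_combination hsum + a' (m + 1) * ((q.1 - p.1) * h₂ - (q.2 - p.2) * h₁)
    + a' (m + 1) * hpq - a' (m + 2) * hqr
end

section
/- On ℍ, with the Hwang–Singer data and τ := 2ρ, one has at every point: (∂τ/∂r)·(∂x₁/∂H) − (∂τ/∂H)·(∂x₁/∂r) = r(1 + ρ)/ρ², and consequently r·((∂τ/∂H)² + (∂τ/∂r)²) / ((∂τ/∂r)·(∂x₁/∂H) − (∂τ/∂H)·(∂x₁/∂r)) = 2τ²/(2 + τ). This is the momentum profile of the Hwang–Singer metric. -/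
/-- The partial derivative of `√(a² + b²)` in the first variable. -/
theorem hasDerivAt_sqrt_sq_add_sq_left_s13 {a b : ℝ} (h : a ^ 2 + b ^ 2 ≠ 0) :
    HasDerivAt (fun t : ℝ => Real.sqrt (t ^ 2 + b ^ 2)) (a / Real.sqrt (a ^ 2 + b ^ 2)) a := by
  have h' := ((hasDerivAt_pow 2 a).add_const (b ^ 2)).sqrt h
  simpa [mul_div_mul_left] using h'

/-- The partial derivative of `√(a² + b²)` in the second variable. -/
theorem hasDerivAt_sqrt_sq_add_sq_right_s13 {a b : ℝ} (h : a ^ 2 + b ^ 2 ≠ 0) :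
    HasDerivAt (fun t : ℝ => Real.sqrt (a ^ 2 + t ^ 2)) (b / Real.sqrt (a ^ 2 + b ^ 2)) b := by
  rw [add_comm] at h
  simpa only [add_comm] using hasDerivAt_sqrt_sq_add_sq_left_s13 h

/-- On `ℍ = {(H,r) : r > 0}`, with the Hwang–Singer data
`ρ = √(H²+r²)`, `x₁ = (H+ρ)/2 + H/(2ρ)` and momentum coordinate `τ = 2ρ`, one has
at every point: `(∂τ/∂r)(∂x₁/∂H) − (∂τ/∂H)(∂x₁/∂r) = r(1+ρ)/ρ²`, and consequently
`r·((∂τ/∂H)² + (∂τ/∂r)²)/((∂τ/∂r)(∂x₁/∂H) − (∂τ/∂H)(∂x₁/∂r)) = 2τ²/(2+τ)`. -/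
theorem stmt_13 (x₁ τ : ℝ → ℝ → ℝ)
    (hx₁ : ∀ H r : ℝ, x₁ H r =
      (H + Real.sqrt (H^2 + r^2)) / 2 + H / (2 * Real.sqrt (H^2 + r^2)))
    (hτ : ∀ H r : ℝ, τ H r = 2 * Real.sqrt (H^2 + r^2)) :
    ∀ H r : ℝ, 0 < r →
      (deriv (fun r' => τ H r') r * deriv (fun H' => x₁ H' r) H
          - deriv (fun H' => τ H' r) H * deriv (fun r' => x₁ H r') r
        = r * (1 + Real.sqrt (H^2 + r^2)) / (Real.sqrt (H^2 + r^2))^2) ∧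
      (r * ((deriv (fun H' => τ H' r) H)^2 + (deriv (fun r' => τ H r') r)^2)
          / (deriv (fun r' => τ H r') r * deriv (fun H' => x₁ H' r) H
              - deriv (fun H' => τ H' r) H * deriv (fun r' => x₁ H r') r)
        = 2 * (τ H r)^2 / (2 + τ H r)) := by
  obtain rfl : x₁ = _ := funext₂ hx₁
  obtain rfl : τ = _ := funext₂ hτ
  intro H r hr
  have hs : 0 < H ^ 2 + r ^ 2 := by positivity
  have hH := hasDerivAt_sqrt_sq_add_sq_left_s13 hs.ne'
  have hR := hasDerivAt_sqrt_sq_add_sq_right_s13 hs.ne'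
  have hsq := Real.sq_sqrt hs.le
  have hpos := Real.sqrt_pos.2 hs
  have h2 : 2 * Real.sqrt (H ^ 2 + r ^ 2) ≠ 0 := by positivity
  have hxH := (((hasDerivAt_id' H).add hH).div_const 2).add
    ((hasDerivAt_id' H).div (hH.const_mul 2) h2)
  have hxR := ((hR.const_add H).div_const 2).add
    ((hasDerivAt_const r H).div (hR.const_mul 2) h2)
  have eH := (hH.const_mul 2).deriv
  have eR := (hR.const_mul 2).deriv
  have exH := hxH.deriv
  have exR := hxR.deriv
  simp only [Pi.add_def, Pi.div_def] at exH exR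
  simp only [eH, eR, exH, exR]
  generalize Real.sqrt (H ^ 2 + r ^ 2) = ρ at *
  have jacobian : 2 * (r / ρ) * ((1 + H / ρ) / 2 +
      (1 * (2 * ρ) - H * (2 * (H / ρ))) / (2 * ρ) ^ 2) -
      2 * (H / ρ) * (r / ρ / 2 + (0 * (2 * ρ) - H * (2 * (r / ρ))) / (2 * ρ) ^ 2) =
      r * (1 + ρ) / ρ ^ 2 := by
    field_simp
    ring
  have gradient : (2 * (H / ρ)) ^ 2 + (2 * (r / ρ)) ^ 2 = 4 := by
    field_simp
    linear_combination -4 * hsq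
  refine ⟨jacobian, ?_⟩
  rw [jacobian, gradient]
  field_simp
  ring
end

section
/- On ℍ, the Hwang–Singer momentum map (H,r) ↦ (x₁(H,r), x₂(H,r)) is injective: if (H,r), (H',r') ∈ ℍ satisfy x₁(H,r) = x₁(H',r') and x₂(H,r) = x₂(H',r'), then H = H' and r = r'. -/
/-- On `ℍ = {(H,r) : r > 0}`, the Hwang–Singer momentum map
`(H,r) ↦ (x₁(H,r), x₂(H,r))`, where `ρ = √(H²+r²)`, `x₁ = (H+ρ)/2 + H/(2ρ)` and
`x₂ = (ρ−H)/2 − H/(2ρ)`, is injective. -/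
theorem stmt_19 (x₁ x₂ : ℝ → ℝ → ℝ)
    (hx₁ : ∀ H r : ℝ, x₁ H r =
      (H + Real.sqrt (H^2 + r^2)) / 2 + H / (2 * Real.sqrt (H^2 + r^2)))
    (hx₂ : ∀ H r : ℝ, x₂ H r =
      (Real.sqrt (H^2 + r^2) - H) / 2 - H / (2 * Real.sqrt (H^2 + r^2))) :
    ∀ H r H' r' : ℝ, 0 < r → 0 < r' →
      x₁ H r = x₁ H' r' → x₂ H r = x₂ H' r' → H = H' ∧ r = r' := by
  intro H r H' r' hr hr' h₁ h₂
  rw [hx₁, hx₁] at h₁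
  rw [hx₂, hx₂] at h₂
  have hρ : √(H ^ 2 + r ^ 2) = √(H' ^ 2 + r' ^ 2) := by linarith
  have hpos : 0 < √(H ^ 2 + r ^ 2) := by positivity
  have hsq : H ^ 2 + r ^ 2 = H' ^ 2 + r' ^ 2 :=
    (Real.sqrt_inj (by positivity) (by positivity)).1 hρ
  rw [← hρ] at h₁
  generalize √(H ^ 2 + r ^ 2) = ρ at h₁ hpos
  have hH : H = H' := by
    have hfac : (H - H') * (1 + 1 / ρ) = 0 := by linear_combination 2 * h₁
    have hne : 1 + 1 / ρ ≠ 0 := by positivity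
    exact sub_eq_zero.1 ((mul_eq_zero.1 hfac).resolve_right hne)
  refine ⟨hH, ?_⟩
  subst hH
  exact (pow_left_inj₀ hr.le hr'.le two_ne_zero).1 (add_left_cancel hsq)
end
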